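/- Let γ > 0 and ω ∈ ℝ, let φ_{ω,γ}(x) = e^{(ω+1)/2} · e^{-(|x|+γ/2)²/2}, and define, for f : ℝ → ℂ continuous and differentiable with f, its derivative f', and x ↦ x·f(x) square-integrable on ℝ (call such f admissible), the quadratic form B₁^γ(f) = ∫_ℝ |f'(x)|² dx + ∫_ℝ ((|x| + γ/2)² - 3)·|f(x)|² dx - γ·|f(0)|². Then: (a) B₁^γ(φ_{ω,γ}) < 0; and (b) for any admissible functions f₁, f₂ that are linearly independent over ℂ, there exists (c₁, c₂) ∈ ℂ² with (c₁, c₂) ≠ (0,0) such that B₁^γ(c₁f₁ + c₂f₂) ≥ 0. -/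

import Mathlib

open MeasureTheory Filter Set Topology

/-- Membership in the weighted space `W̃`: `f` is continuous and differentiable with
`f`, `f'`, and `x ↦ x·f(x)` square-integrable on `ℝ`. -/
def Admissible (f : ℝ → ℂ) : Prop :=
  Continuous f ∧ Differentiable ℝ f ∧
  Integrable (fun x => ‖f x‖ ^ 2) ∧
  Integrable (fun x => ‖deriv f x‖ ^ 2) ∧
  Integrable (fun x => ‖x • f x‖ ^ 2)

/-- The quadratic form of the linearized operator `L₁^γ = -d²/dx² + (|x|+γ/2)² - 3`
with δ-interaction of strength `γ`. -/
noncomputable def B1 (γ : ℝ) (f : ℝ → ℂ) : ℝ :=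
  (∫ x : ℝ, ‖deriv f x‖ ^ 2) + (∫ x : ℝ, ((|x| + γ / 2) ^ 2 - 3) * ‖f x‖ ^ 2)
    - γ * ‖f 0‖ ^ 2

lemma Admissible.memLp {f : ℝ → ℂ} (hf : Admissible f) :
    MemLp f 2 ∧ MemLp (deriv f) 2 ∧ MemLp (fun x : ℝ => x • f x) 2 :=
  ⟨(memLp_two_iff_integrable_sq_norm hf.1.aestronglyMeasurable).2 hf.2.2.1,
    (memLp_two_iff_integrable_sq_norm (stronglyMeasurable_deriv f).aestronglyMeasurable).2
      hf.2.2.2.1,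
    (memLp_two_iff_integrable_sq_norm
      (continuous_id.smul hf.1).aestronglyMeasurable).2 hf.2.2.2.2⟩

lemma Admissible.linearCombination {f g : ℝ → ℂ} (hf : Admissible f) (hg : Admissible g)
    (c d : ℂ) : Admissible (c • f + d • g) := by
  obtain ⟨hf₀, hf₁, hf₂⟩ := hf.memLp
  obtain ⟨hg₀, hg₁, hg₂⟩ := hg.memLp
  refine ⟨(hf.1.const_smul c).add (hg.1.const_smul d),
    (hf.2.1.const_smul c).add (hg.2.1.const_smul d),
    ((hf₀.const_smul c).add (hg₀.const_smul d)).integrable_norm_pow two_ne_zero, ?_, ?_⟩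
  · have h : deriv (c • f + d • g) = c • deriv f + d • deriv g := by
      ext x
      exact (((hf.2.1 x).hasDerivAt.const_smul c).add ((hg.2.1 x).hasDerivAt.const_smul d)).deriv
    rw [h]
    exact ((hf₁.const_smul c).add (hg₁.const_smul d)).integrable_norm_pow two_ne_zero
  · have h : (fun x : ℝ => x • (c • f + d • g) x)
        = c • (fun x : ℝ => x • f x) + d • (fun x : ℝ => x • g x) := by
      ext x
      simp only [Pi.add_apply, Pi.smul_apply, smul_eq_mul, Complex.real_smul]
      ring
    have := ((hf₂.const_smul c).add (hg₂.const_smul d)).integrable_norm_pow two_ne_zero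
    rw [← h] at this
    exact this

lemma Admissible.comp_neg {f : ℝ → ℂ} (hf : Admissible f) : Admissible fun x => f (-x) := by
  obtain ⟨hc, hd, h₀, h₁, h₂⟩ := hf
  refine ⟨hc.comp continuous_neg, hd.comp differentiable_neg, h₀.comp_neg, ?_, ?_⟩
  · simpa [deriv_comp_neg] using h₁.comp_neg
  · simpa using h₂.comp_neg

lemma Admissible.integrable_potential {f : ℝ → ℂ} (hf : Admissible f) (a : ℝ) :
    Integrable fun x => ((|x| + a) ^ 2 - 3) * ‖f x‖ ^ 2 := by
  obtain ⟨hc, -, h₀, -, h₂⟩ := hf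
  refine ((h₂.const_mul 2).add (h₀.const_mul (2 * a ^ 2 + 3))).mono'
    (by fun_prop) (ae_of_all _ fun x => ?_)
  have hx : ‖x • f x‖ ^ 2 = |x| ^ 2 * ‖f x‖ ^ 2 := by
    rw [norm_smul, mul_pow, Real.norm_eq_abs]
  simp only [Pi.add_apply, hx, norm_mul, norm_pow, abs_norm, Real.norm_eq_abs]
  have : |(|x| + a) ^ 2 - 3| ≤ 2 * |x| ^ 2 + (2 * a ^ 2 + 3) := by
    rw [abs_le]
    constructor <;> nlinarith [sq_nonneg (|x| - a), sq_nonneg (|x| + a), sq_nonneg |x|, sq_nonneg a]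
  nlinarith [mul_le_mul_of_nonneg_right this (sq_nonneg ‖f x‖)]

/-- The shifted first excited state `(x + a) exp (-(x + a)² / 2)` of the harmonic oscillator is
positive on the half-line, so the form is nonnegative under a Dirichlet condition. -/
lemma Admissible.integral_Ioi_nonneg {f : ℝ → ℂ} (hf : Admissible f) (hf0 : f 0 = 0) {a : ℝ}
    (ha : 0 < a) :
    0 ≤ ∫ x in Ioi (0 : ℝ), (‖deriv f x‖ ^ 2 + ((|x| + a) ^ 2 - 3) * ‖f x‖ ^ 2) := by
  obtain ⟨hc, hd, h₀, h₁, h₂⟩ := id hf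
  let w : ℝ → ℝ := fun x => (|x| + a)⁻¹ - (|x| + a)
  let F : ℝ → ℝ := fun x =>
    (‖deriv f x‖ ^ 2 + ((|x| + a) ^ 2 - 3) * ‖f x‖ ^ 2) - ‖deriv f x - w x • f x‖ ^ 2
  have hpos : ∀ x : ℝ, 0 < |x| + a := fun x => by positivity
  have hwc : Continuous w := by
    have : ∀ x : ℝ, |x| + a ≠ 0 := fun x => (hpos x).ne'
    fun_prop (disch := assumption)
  have hwb : ∀ x, |w x| ≤ |x| + (a⁻¹ + a) := fun x => by
    have h1 : (|x| + a)⁻¹ ≤ a⁻¹ := inv_anti₀ ha (by linarith [abs_nonneg x])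
    have h2 : 0 < (|x| + a)⁻¹ := inv_pos.2 (hpos x)
    have h3 : 0 < a⁻¹ := inv_pos.2 ha
    simp only [w, abs_le]
    constructor <;> linarith [abs_nonneg x]
  obtain ⟨m₀, m₁, m₂⟩ := hf.memLp
  have hwf : MemLp (fun x => w x • f x) 2 := by
    refine (m₂.norm.add (m₀.norm.const_mul (a⁻¹ + a))).mono' (by fun_prop) (ae_of_all _ fun x => ?_)
    simp only [Pi.add_apply, norm_smul, Real.norm_eq_abs]
    nlinarith [mul_le_mul_of_nonneg_right (hwb x) (norm_nonneg (f x))]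
  have hE : Integrable fun x => ‖deriv f x‖ ^ 2 + ((|x| + a) ^ 2 - 3) * ‖f x‖ ^ 2 :=
    h₁.add (hf.integrable_potential a)
  have hS : Integrable fun x => ‖deriv f x - w x • f x‖ ^ 2 :=
    (m₁.sub hwf).integrable_norm_pow two_ne_zero
  have hF : Integrable F := hE.sub hS
  have hG : Integrable fun x => w x * ‖f x‖ ^ 2 := by
    refine (m₀.norm.integrable_mul hwf.norm).mono' (by fun_prop) (ae_of_all _ fun x => le_of_eq ?_)
    simp only [Pi.mul_apply, norm_mul, norm_smul, norm_pow, norm_norm]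
    ring
  have hder : ∀ x ∈ Ioi (0 : ℝ), HasDerivAt (fun x => w x * ‖f x‖ ^ 2) (F x) x := by
    intro x hx
    have hx0 : 0 < x := hx
    have hne : x + a ≠ 0 := by positivity
    have hw : HasDerivAt w (-1 / (x + a) ^ 2 - 1) x := by
      have h := (hasDerivAt_id x).add_const a
      refine ((h.inv hne).sub h).congr_of_eventuallyEq ?_
      filter_upwards [Ioi_mem_nhds hx0] with y hy
      simp [w, abs_of_pos (show 0 < y from hy)]
    refine (hw.mul (hd x).hasDerivAt.norm_sq).congr_deriv ?_
    have hwx : w x = (x + a)⁻¹ - (x + a) := by simp only [w, abs_of_pos hx0]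
    simp only [F]
    rw [norm_sub_sq_real, norm_smul, mul_pow, Real.norm_eq_abs, sq_abs, real_inner_smul_right,
      real_inner_comm, abs_of_pos hx0, hwx]
    field_simp
    ring
  have hlim := tendsto_zero_of_hasDerivAt_of_integrableOn_Ioi hder hF.integrableOn hG.integrableOn
  have hint : ∫ x in Ioi (0 : ℝ), F x = 0 - w 0 * ‖f 0‖ ^ 2 := integral_Ioi_of_hasDerivAt_of_tendsto
    (hwc.mul (hc.norm.pow 2)).continuousWithinAt hder hF.integrableOn hlim
  have hsub : ∫ x in Ioi (0 : ℝ), F x = _ := integral_sub hE.integrableOn hS.integrableOn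
  rw [hsub] at hint
  simp only [hf0, norm_zero, zero_pow two_ne_zero, mul_zero, sub_zero] at hint
  have : 0 ≤ ∫ x in Ioi (0 : ℝ), ‖deriv f x - w x • f x‖ ^ 2 :=
    integral_nonneg fun x => sq_nonneg _
  linarith

lemma Admissible.B1_nonneg {f : ℝ → ℂ} (hf : Admissible f) (hf0 : f 0 = 0) {γ : ℝ}
    (hγ : 0 < γ) : 0 ≤ B1 γ f := by
  have ha : 0 < γ / 2 := by positivity
  have h₁ := hf.2.2.2.1
  have h₂ := hf.integrable_potential (γ / 2)
  have hE : Integrable fun x => ‖deriv f x‖ ^ 2 + ((|x| + γ / 2) ^ 2 - 3) * ‖f x‖ ^ 2 := h₁.add h₂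
  have hR := hf.integral_Ioi_nonneg hf0 ha
  have hL := hf.comp_neg.integral_Ioi_nonneg (by simpa using hf0) ha
  have hneg := integral_comp_neg_Ioi (0 : ℝ)
    (fun x => ‖deriv f x‖ ^ 2 + ((|x| + γ / 2) ^ 2 - 3) * ‖f x‖ ^ 2)
  simp only [deriv_comp_neg, norm_neg] at hL
  simp only [abs_neg, neg_zero] at hneg
  rw [hneg] at hL
  rw [B1, hf0, ← integral_add h₁ h₂,
    ← intervalIntegral.integral_Iic_add_Ioi hE.integrableOn hE.integrableOn (b := 0)]
  simp only [norm_zero]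
  linarith

lemma integrable_exp_neg_add_sq (a : ℝ) : Integrable fun x : ℝ => Real.exp (-(x + a) ^ 2) := by
  have h := (integrable_exp_neg_mul_sq one_pos).comp_add_right a
  simpa using h

lemma integrable_sq_mul_exp_neg_add_sq (a : ℝ) :
    Integrable fun x : ℝ => (x + a) ^ 2 * Real.exp (-(x + a) ^ 2) := by
  have h := (integrable_rpow_mul_exp_neg_mul_sq one_pos (s := 2) (by norm_num)).comp_add_right a
  simpa using h

lemma integral_Ioi_two_sq_sub_one_mul_exp (a : ℝ) :
    ∫ x in Ioi (0 : ℝ), (2 * (x + a) ^ 2 - 1) * Real.exp (-(x + a) ^ 2)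
      = a * Real.exp (-a ^ 2) := by
  have hder : ∀ x : ℝ, HasDerivAt (fun x => -((x + a) * Real.exp (-(x + a) ^ 2)))
      ((2 * (x + a) ^ 2 - 1) * Real.exp (-(x + a) ^ 2)) x := by
    intro x
    have h := (hasDerivAt_id x).add_const a
    refine (h.mul (h.pow 2).neg.exp).neg.congr_deriv ?_
    simp
    ring
  have hI : Integrable fun x : ℝ => (2 * (x + a) ^ 2 - 1) * Real.exp (-(x + a) ^ 2) := by
    refine (((integrable_sq_mul_exp_neg_add_sq a).const_mul 2).sub
      (integrable_exp_neg_add_sq a)).congr (ae_of_all _ fun x => ?_)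
    simp only [Pi.sub_apply]
    ring
  have hG : Integrable fun x : ℝ => -((x + a) * Real.exp (-(x + a) ^ 2)) := by
    have h := (integrable_mul_exp_neg_mul_sq one_pos).comp_add_right a
    simpa using h.neg
  have h := integral_Ioi_of_hasDerivAt_of_tendsto' (a := 0) (fun x _ => hder x) hI.integrableOn
    (tendsto_zero_of_hasDerivAt_of_integrableOn_Ioi (a := 0) (fun x _ => hder x)
      hI.integrableOn hG.integrableOn)
  simpa using h

lemma norm_deriv_sq_gaussian_abs {φ : ℝ → ℂ} {C a : ℝ}
    (hφ : ∀ x : ℝ, φ x = ((C * Real.exp (-(|x| + a) ^ 2 / 2) : ℝ) : ℂ)) {x : ℝ} (hx : x ≠ 0) :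
    ‖deriv φ x‖ ^ 2 = C ^ 2 * ((|x| + a) ^ 2 * Real.exp (-(|x| + a) ^ 2)) := by
  have hφ' : φ = fun x : ℝ => ((C * Real.exp (-(|x| + a) ^ 2 / 2) : ℝ) : ℂ) := funext hφ
  have hd : HasDerivAt φ ((C * (Real.exp (-(|x| + a) ^ 2 / 2)
      * (-(2 * (|x| + a) * SignType.sign x) / 2)) : ℝ) : ℂ) x := by
    rw [hφ']
    have h := (((hasDerivAt_abs hx).add_const a).pow 2).neg.div_const 2
    simpa using (h.exp.const_mul C).ofReal_comp
  have he : Real.exp (-(|x| + a) ^ 2 / 2) ^ 2 = Real.exp (-(|x| + a) ^ 2) := by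
    rw [← Real.exp_nat_mul]
    congr 1
    push_cast
    ring
  have hs : (SignType.sign x : ℝ) ^ 2 = 1 := by
    rcases hx.lt_or_gt with h | h <;> simp [h]
  rw [hd.deriv, Complex.norm_real, Real.norm_eq_abs, sq_abs, ← he]
  linear_combination C ^ 2 * (|x| + a) ^ 2 * Real.exp (-(|x| + a) ^ 2 / 2) ^ 2 * hs

lemma B1_gaussian_abs_neg {φ : ℝ → ℂ} {C γ : ℝ} (hC : 0 < C)
    (hφ : ∀ x : ℝ, φ x = ((C * Real.exp (-(|x| + γ / 2) ^ 2 / 2) : ℝ) : ℂ)) :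
    B1 γ φ < 0 := by
  obtain ⟨a, rfl⟩ : ∃ a, γ = 2 * a := ⟨γ / 2, by ring⟩
  simp only [mul_div_cancel_left₀ a (two_ne_zero' ℝ)] at hφ
  have hsq : ∀ x, ‖φ x‖ ^ 2 = C ^ 2 * Real.exp (-(|x| + a) ^ 2) := fun x => by
    rw [hφ, Complex.norm_real, Real.norm_eq_abs, sq_abs, mul_pow, ← Real.exp_nat_mul]
    congr 2
    push_cast
    ring
  have hI₀ := (integrable_exp_neg_add_sq a).integrableOn (s := Ioi 0)
  have hI₂ := (integrable_sq_mul_exp_neg_add_sq a).integrableOn (s := Ioi 0)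
  have h₁ : ∫ x, ‖deriv φ x‖ ^ 2
      = 2 * ∫ x in Ioi (0 : ℝ), C ^ 2 * ((x + a) ^ 2 * Real.exp (-(x + a) ^ 2)) := by
    rw [← integral_comp_abs (f := fun x => C ^ 2 * ((x + a) ^ 2 * Real.exp (-(x + a) ^ 2)))]
    refine integral_congr_ae ?_
    filter_upwards [compl_mem_ae_iff.2 (measure_singleton (0 : ℝ))] with x hx
    exact norm_deriv_sq_gaussian_abs hφ hx
  have h₂ : ∫ x : ℝ, ((|x| + 2 * a / 2) ^ 2 - 3) * ‖φ x‖ ^ 2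
      = 2 * ∫ x in Ioi (0 : ℝ), ((x + a) ^ 2 - 3) * (C ^ 2 * Real.exp (-(x + a) ^ 2)) := by
    rw [← integral_comp_abs
      (f := fun x => ((x + a) ^ 2 - 3) * (C ^ 2 * Real.exp (-(x + a) ^ 2)))]
    simp only [hsq, mul_div_cancel_left₀ a (two_ne_zero' ℝ)]
  have h₃ : ∫ x in Ioi (0 : ℝ), ((x + a) ^ 2 - 3) * (C ^ 2 * Real.exp (-(x + a) ^ 2))
      = C ^ 2 * (∫ x in Ioi (0 : ℝ), (x + a) ^ 2 * Real.exp (-(x + a) ^ 2))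
        - 3 * C ^ 2 * ∫ x in Ioi (0 : ℝ), Real.exp (-(x + a) ^ 2) := by
    rw [← integral_const_mul, ← integral_const_mul,
      ← integral_sub (hI₂.const_mul _) (hI₀.const_mul _)]
    congr 1 with x
    ring
  have h₄ : 2 * (∫ x in Ioi (0 : ℝ), (x + a) ^ 2 * Real.exp (-(x + a) ^ 2))
      - ∫ x in Ioi (0 : ℝ), Real.exp (-(x + a) ^ 2) = a * Real.exp (-a ^ 2) := by
    rw [← integral_Ioi_two_sq_sub_one_mul_exp, ← integral_const_mul,
      ← integral_sub (hI₂.const_mul _) hI₀]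
    congr 1 with x
    ring
  have h₅ : 0 < ∫ x in Ioi (0 : ℝ), Real.exp (-(x + a) ^ 2) := by
    have : NeZero (volume.restrict (Ioi (0 : ℝ))) := ⟨by simp⟩
    exact integral_exp_pos hI₀
  rw [B1, h₁, h₂, h₃, integral_const_mul, hsq]
  simp only [abs_zero, zero_add]
  have hC2 : 0 < C ^ 2 := by positivity
  linear_combination 2 * C ^ 2 * h₄ + 4 * C ^ 2 * h₅

/-- For `γ > 0`, the operator `L₁^γ` has exactly one negative eigenvalue, expressed via
its quadratic form: (a) the form is negative at the peak-Gausson profile `φ_{ω,γ}`; and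
(b) it is not negative definite on any two-dimensional subspace of `W̃`. -/
theorem stmt15 (γ : ℝ) (hγ : 0 < γ) (ω : ℝ) (φ : ℝ → ℂ)
    (hφ : ∀ x : ℝ, φ x
      = ((Real.exp ((ω + 1) / 2) * Real.exp (-(|x| + γ / 2) ^ 2 / 2) : ℝ) : ℂ)) :
    B1 γ φ < 0 ∧
    (∀ f₁ f₂ : ℝ → ℂ, Admissible f₁ → Admissible f₂ →
      LinearIndependent ℂ ![f₁, f₂] →
      ∃ c₁ c₂ : ℂ, ¬(c₁ = 0 ∧ c₂ = 0) ∧ 0 ≤ B1 γ (c₁ • f₁ + c₂ • f₂)) := by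
  refine ⟨B1_gaussian_abs_neg (Real.exp_pos _) hφ, fun f₁ f₂ h₁ h₂ _ => ?_⟩
  obtain ⟨c₁, c₂, hc, h0⟩ : ∃ c₁ c₂ : ℂ, ¬(c₁ = 0 ∧ c₂ = 0) ∧ c₁ * f₁ 0 + c₂ * f₂ 0 = 0 := by
    by_cases h : f₁ 0 = 0
    · exact ⟨1, 0, by simp, by simp [h]⟩
    · exact ⟨f₂ 0, -f₁ 0, by simp [h], by ring⟩
  exact ⟨c₁, c₂, hc, (h₁.linearCombination h₂ c₁ c₂).B1_nonneg (by simpa using h0) hγ⟩
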